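/- arXiv:2112.10625 — 2 statements merged into one kernel-verified Lean document; each statement's English description precedes it below -/
import Mathlib

section
/- Let n, m ≥ 1 and N ≥ 1. Let f : ℝⁿ → ℝⁿ, g : ℝⁿ → ℝ^{n×m}, let 𝒳, 𝒳_f ⊆ ℝⁿ and 𝒰 ⊆ ℝᵐ, let P_x, P_u be invertible matrices and t_x ∈ ℝⁿ, t_u ∈ ℝᵐ, and fix an initial state x₀ ∈ ℝⁿ. Call an input sequence U = (u_0, …, u_{N−1}) feasible for P-1 if the trajectory defined by x_0 = x₀ and x_{i+1} = f(x_i) + g(x_i)u_i satisfies x_i ∈ 𝒳 for i = 0, …, N−1, u_i ∈ 𝒰 for i = 0, …, N−1, and x_N ∈ 𝒳_f; call Ū = (ū_0, …, ū_{N−1}) feasible for P-2 if the trajectory defined by x̄_0 = ι_x(x₀) and x̄_{i+1} = f̄(x̄_i) + ḡ(x̄_i)ū_i satisfies x̄_i ∈ ι_x''𝒳, ū_i ∈ ι_u''𝒰, and x̄_N ∈ ι_x''𝒳_f. Then the componentwise map U ↦ (ι_u(u_0), …, ι_u(u_{N−1})) is a bijection from the set of feasible input sequences of P-1 onto the set of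 feasible input sequences of P-2. -/
open Matrix

/-- The trajectory of a controlled discrete-time system `x_{k+1} = Φ(x_k, u_k)`
starting from `x0` under the input sequence `U`. -/
def traj {α β : Type*} (Φ : α → β → α) (x0 : α) (U : ℕ → β) : ℕ → α
  | 0 => x0
  | k + 1 => Φ (traj Φ x0 U k) (U k)

/-- Trajectories of semiconjugate controlled systems correspond under the semiconjugacy. -/
theorem traj_semiconj {α β γ δ : Type*} {Φ : α → β → α} {Ψ : γ → δ → γ} {a : α → γ} {b : β → δ}
    (h : ∀ x u, Ψ (a x) (b u) = a (Φ x u)) (x0 : α) (U : ℕ → β) (k : ℕ) :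
    traj Ψ (a x0) (fun i => b (U i)) k = a (traj Φ x0 U k) := by
  induction k with
  | zero => rfl
  | succ k ih => simp only [traj, ih, h]

/-- The affine map `v ↦ P (v + t)` with `P` invertible is a bijection. -/
theorem bijective_mulVec_add {k : ℕ} {P : Matrix (Fin k) (Fin k) ℝ} (hP : IsUnit P.det)
    (t : Fin k → ℝ) : Function.Bijective fun v => P.mulVec (v + t) := by
  refine Function.bijective_iff_has_inverse.2 ⟨fun w => P⁻¹.mulVec w - t, fun v => ?_, fun w => ?_⟩
  · simp [Matrix.nonsing_inv_mul P hP]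
  · simp [Matrix.mul_nonsing_inv P hP]

/-- The componentwise affine mask `U ↦ (ι_u(u_0), …, ι_u(u_{N−1}))`
is a bijection from the set of feasible input sequences of the original
problem P-1 onto the set of feasible input sequences of the transformed
problem P-2. -/
theorem affine_mask_feasible_bijection {n m : ℕ} (hn : 1 ≤ n) (hm : 1 ≤ m)
    (N : ℕ) (hN : 1 ≤ N)
    (f : (Fin n → ℝ) → (Fin n → ℝ))
    (g : (Fin n → ℝ) → Matrix (Fin n) (Fin m) ℝ)
    (X Xf : Set (Fin n → ℝ)) (Uset : Set (Fin m → ℝ))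
    (Px : Matrix (Fin n) (Fin n) ℝ) (Pu : Matrix (Fin m) (Fin m) ℝ)
    (hPx : IsUnit Px.det) (hPu : IsUnit Pu.det)
    (tx : Fin n → ℝ) (tu : Fin m → ℝ) (x0 : Fin n → ℝ)
    (ιx : (Fin n → ℝ) → (Fin n → ℝ)) (hιx : ∀ x, ιx x = Px.mulVec (x + tx))
    (ιu : (Fin m → ℝ) → (Fin m → ℝ)) (hιu : ∀ u, ιu u = Pu.mulVec (u + tu))
    (ιxinv : (Fin n → ℝ) → (Fin n → ℝ))
    (hιxinv : ∀ xb, ιxinv xb = Px⁻¹.mulVec xb - tx)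
    (fbar : (Fin n → ℝ) → (Fin n → ℝ))
    (hfbar : ∀ xb, fbar xb =
      Px.mulVec (f (ιxinv xb) - (g (ιxinv xb)).mulVec tu + tx))
    (gbar : (Fin n → ℝ) → Matrix (Fin n) (Fin m) ℝ)
    (hgbar : ∀ xb, gbar xb = Px * g (ιxinv xb) * Pu⁻¹)
    (Feas1 : Set (ℕ → Fin m → ℝ))
    (hFeas1 : Feas1 = {U |
      (∀ i < N, traj (fun x u => f x + (g x).mulVec u) x0 U i ∈ X) ∧
      (∀ i < N, U i ∈ Uset) ∧
      traj (fun x u => f x + (g x).mulVec u) x0 U N ∈ Xf})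
    (Feas2 : Set (ℕ → Fin m → ℝ))
    (hFeas2 : Feas2 = {Ub |
      (∀ i < N,
        traj (fun xb ub => fbar xb + (gbar xb).mulVec ub) (ιx x0) Ub i ∈ ιx '' X) ∧
      (∀ i < N, Ub i ∈ ιu '' Uset) ∧
      traj (fun xb ub => fbar xb + (gbar xb).mulVec ub) (ιx x0) Ub N ∈ ιx '' Xf}) :
    Set.BijOn (fun U : ℕ → Fin m → ℝ => fun i => ιu (U i)) Feas1 Feas2 := by
  obtain rfl : ιx = fun x => Px.mulVec (x + tx) := funext hιx
  obtain rfl : ιu = fun u => Pu.mulVec (u + tu) := funext hιu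
  have hx := bijective_mulVec_add hPx tx
  have hu := bijective_mulVec_add hPu tu
  have hinv : ∀ x, ιxinv (Px.mulVec (x + tx)) = x := fun x => by
    simp [hιxinv, Matrix.nonsing_inv_mul Px hPx]
  have hstep : ∀ x u, fbar (Px.mulVec (x + tx)) +
      (gbar (Px.mulVec (x + tx))).mulVec (Pu.mulVec (u + tu)) =
        Px.mulVec (f x + (g x).mulVec u + tx) := fun x u => by
    rw [hfbar, hgbar, hinv, Matrix.mulVec_mulVec, Matrix.mul_assoc,
      Matrix.nonsing_inv_mul Pu hPu, Matrix.mul_one, ← Matrix.mulVec_mulVec,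
      ← Matrix.mulVec_add, Matrix.mulVec_add (g x)]
    congr 1
    abel
  have htraj := traj_semiconj (Φ := fun x u => f x + (g x).mulVec u)
    (Ψ := fun xb ub => fbar xb + (gbar xb).mulVec ub)
    (a := fun x => Px.mulVec (x + tx)) (b := fun u => Pu.mulVec (u + tu)) hstep x0
  have hpre : Feas1 = (fun U : ℕ → Fin m → ℝ => fun i => Pu.mulVec (U i + tu)) ⁻¹' Feas2 := by
    ext U
    have hX := fun (S : Set (Fin n → ℝ)) x => hx.injective.mem_set_image (s := S) (a := x)
    have hU := fun (S : Set (Fin m → ℝ)) u => hu.injective.mem_set_image (s := S) (a := u)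
    simp only [hFeas1, hFeas2, Set.mem_preimage, Set.mem_ofPred_eq, htraj, hX, hU]
  rw [hpre]
  have hseq : Function.Bijective (fun U : ℕ → Fin m → ℝ => fun i => Pu.mulVec (U i + tu)) :=
    Function.Bijective.piMap fun _ => hu
  exact hseq.bijOn_preimage
end

section
/- Let n, m, p ≥ 1, let f : ℝⁿ → ℝⁿ, g : ℝⁿ → ℝ^{n×m}, C ∈ ℝ^{p×n}, H ∈ ℝ^{n×p}, let P_x, P_u, P_y be invertible matrices of sizes n×n, m×m, p×p, and let t_x ∈ ℝⁿ, t_u ∈ ℝᵐ, t_y ∈ ℝᵖ. Define C̄ = P_y C P_x⁻¹, σ̄_y = P_y(−C t_x + t_y), and H̄ = P_x H P_y⁻¹. Then for all x̂, x̂⁺ ∈ ℝⁿ, u ∈ ℝᵐ, y ∈ ℝᵖ, the observer update x̂⁺ = f(x̂) + g(x̂)u + H(y − C x̂) holds if and only if ι_x(x̂⁺) = f̄(ι_x(x̂)) + ḡ(ι_x(x̂))·ι_u(u) + H̄(ι_y(y) − C̄ ι_x(x̂) − σ̄_y). In words: the affine masks map trajectories of the original state observer exactly to trajectories of the transformed observer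 run by the cloud on masked outputs. -/
open Matrix

/-- The affine masks map trajectories of the original state
observer `x̂⁺ = f(x̂) + g(x̂)u + H(y − Cx̂)` exactly to trajectories of the
transformed observer `x̄̂⁺ = f̄(x̄̂) + ḡ(x̄̂)ū + H̄(ȳ − C̄x̄̂ − σ̄_y)` run by the
cloud on masked outputs. -/
theorem affine_mask_observer_equiv {n m p : ℕ}
    (hn : 1 ≤ n) (hm : 1 ≤ m) (hp : 1 ≤ p)
    (f : (Fin n → ℝ) → (Fin n → ℝ))
    (g : (Fin n → ℝ) → Matrix (Fin n) (Fin m) ℝ)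
    (C : Matrix (Fin p) (Fin n) ℝ) (H : Matrix (Fin n) (Fin p) ℝ)
    (Px : Matrix (Fin n) (Fin n) ℝ) (Pu : Matrix (Fin m) (Fin m) ℝ)
    (Py : Matrix (Fin p) (Fin p) ℝ)
    (hPx : IsUnit Px.det) (hPu : IsUnit Pu.det) (hPy : IsUnit Py.det)
    (tx : Fin n → ℝ) (tu : Fin m → ℝ) (ty : Fin p → ℝ)
    (ιx : (Fin n → ℝ) → (Fin n → ℝ)) (hιx : ∀ x, ιx x = Px.mulVec (x + tx))
    (ιu : (Fin m → ℝ) → (Fin m → ℝ)) (hιu : ∀ u, ιu u = Pu.mulVec (u + tu))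
    (ιy : (Fin p → ℝ) → (Fin p → ℝ)) (hιy : ∀ y, ιy y = Py.mulVec (y + ty))
    (ιxinv : (Fin n → ℝ) → (Fin n → ℝ))
    (hιxinv : ∀ xb, ιxinv xb = Px⁻¹.mulVec xb - tx)
    (fbar : (Fin n → ℝ) → (Fin n → ℝ))
    (hfbar : ∀ xb, fbar xb =
      Px.mulVec (f (ιxinv xb) - (g (ιxinv xb)).mulVec tu + tx))
    (gbar : (Fin n → ℝ) → Matrix (Fin n) (Fin m) ℝ)
    (hgbar : ∀ xb, gbar xb = Px * g (ιxinv xb) * Pu⁻¹)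
    (Cbar : Matrix (Fin p) (Fin n) ℝ) (hCbar : Cbar = Py * C * Px⁻¹)
    (σy : Fin p → ℝ) (hσy : σy = Py.mulVec (-(C.mulVec tx) + ty))
    (Hbar : Matrix (Fin n) (Fin p) ℝ) (hHbar : Hbar = Px * H * Py⁻¹) :
    ∀ (xhat xhatplus : Fin n → ℝ) (u : Fin m → ℝ) (y : Fin p → ℝ),
      xhatplus = f xhat + (g xhat).mulVec u + H.mulVec (y - C.mulVec xhat) ↔
        ιx xhatplus = fbar (ιx xhat) + (gbar (ιx xhat)).mulVec (ιu u) +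
          Hbar.mulVec (ιy y - Cbar.mulVec (ιx xhat) - σy) := by
  intro xhat xhatplus u y
  have cancel_right : ∀ {k l : ℕ} (A : Matrix (Fin k) (Fin l) ℝ)
      (P : Matrix (Fin l) (Fin l) ℝ), IsUnit P.det → ∀ v : Fin l → ℝ,
      (A * P⁻¹).mulVec (P.mulVec v) = A.mulVec v := by
    intro k l A P hP v
    rw [mulVec_mulVec, nonsing_inv_mul_cancel_right _ _ hP]
  have hinv : ιxinv (ιx xhat) = xhat := by
    rw [hιxinv, hιx, mulVec_mulVec, nonsing_inv_mul _ hPx, one_mulVec, add_sub_cancel_right]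
  have hout : ιy y - Cbar.mulVec (ιx xhat) - σy = Py.mulVec (y - C.mulVec xhat) := by
    rw [hιy, hCbar, hιx, hσy, cancel_right _ _ hPx, ← mulVec_mulVec, ← mulVec_sub,
      ← mulVec_sub, mulVec_add]
    congr 1
    abel
  have hupdate : fbar (ιx xhat) + (gbar (ιx xhat)).mulVec (ιu u) +
      Hbar.mulVec (ιy y - Cbar.mulVec (ιx xhat) - σy) =
      ιx (f xhat + (g xhat).mulVec u + H.mulVec (y - C.mulVec xhat)) := by
    rw [hout, hfbar, hgbar, hinv, hHbar, hιu, hιx, cancel_right _ _ hPu,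
      cancel_right _ _ hPy, ← mulVec_mulVec, ← mulVec_mulVec, ← mulVec_add, ← mulVec_add,
      mulVec_add (g xhat)]
    congr 1
    abel
  have hinj : Function.Injective ιx := by
    intro a b hab
    rw [hιx, hιx] at hab
    exact add_right_cancel
      (mulVec_injective_of_isUnit ((isUnit_iff_isUnit_det Px).mpr hPx) hab)
  rw [hupdate, hinj.eq_iff]
end
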